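/- Let K = F(y) and let τ₁,…,τ_r (1 ≤ r ≤ m) be independent elements of G^τ, meaning that τ₁^{ℓ₁}···τ_r^{ℓ_r} = 1 with ℓ_i ∈ ℤ forces all ℓ_i = 0. Then there exists an injective K-algebra endomorphism φ of K(z) such that φ∘τ_i = τ_{q,z_i}∘φ for all 1 ≤ i ≤ r, and furthermore, for every f ∈ K(z), f is (τ₁,…,τ_r)-summable in K(z) if and only if φ(f) is (τ_{q,z₁},…,τ_{q,z_r})-summable in K(z). -/

import Mathlib

noncomputable section

/-- The field of rational functions `F(x₁,…,xₙ)`, modeled as the fraction field of the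
multivariate polynomial ring. -/
abbrev MvRat (F : Type*) [Field F] (n : ℕ) := FractionRing (MvPolynomial (Fin n) F)

/-- The image of the variable `xᵢ` in `F(x₁,…,xₙ)`. -/
def xv {F : Type*} [Field F] {n : ℕ} (i : Fin n) : MvRat F n :=
  algebraMap (MvPolynomial (Fin n) F) (MvRat F n) (MvPolynomial.X i)

/-- The subfield `F(x₂,…,xₙ)` of `F(x₁,…,xₙ)` (the variable `x₁` has index `0`). -/
def hatField (F : Type*) [Field F] (n : ℕ) [NeZero n] : Subfield (MvRat F n) :=
  Subfield.closure (Set.range (algebraMap F (MvRat F n)) ∪ (xv '' {i : Fin n | i ≠ 0}))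

/-- `a` is a polynomial in `x1` over the subfield `E` of degree `< D`. -/
def IsPolyDeg {L : Type*} [Field L] (E : Subfield L) (x1 : L) (D : ℕ) (a : L) : Prop :=
  ∃ cf : Fin D → E, a = ∑ k : Fin D, (cf k : L) * x1 ^ (k : ℕ)

/-- `a` is a polynomial in `x1` over the subfield `E`, i.e. `a ∈ E[x1]`. -/
def IsPolyE {L : Type*} [Field L] (E : Subfield L) (x1 a : L) : Prop :=
  ∃ D : ℕ, IsPolyDeg E x1 D a

/-- `a` is a Laurent polynomial in `x1` over the subfield `E`, i.e. `a ∈ E[x1, x1⁻¹]`. -/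
def IsLaurent {L : Type*} [Field L] (E : Subfield L) (x1 a : L) : Prop :=
  ∃ (s : Finset ℤ) (cf : ℤ → L), (∀ k ∈ s, cf k ∈ E) ∧ a = ∑ k ∈ s, cf k * x1 ^ k

/-- For a family `θ` of `F`-automorphisms and an exponent vector `α`,
the product `∏ i, θᵢ^(αᵢ)` (the element `θ_x^α` of the group generated by the `θᵢ`). -/
def thetaPowS {F L : Type*} [CommSemiring F] [Semiring L] [Algebra F L] {ι : Type*} [Fintype ι]
    (θ : ι → (L ≃ₐ[F] L)) (α : ι → ℤ) : L ≃ₐ[F] L :=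
  (Finset.univ.toList.map fun i => θ i ^ α i).prod

/-- Membership in the space `V_{[d]_G,j}`: `f` is a finite sum of fractions `a_g / g(d)^j`
with `g` in the group `G` and `a_g ∈ E[x₁]` of degree `< D` (`= deg_{x₁} d`). -/
def MemV {F L : Type*} [Field F] [Field L] [Algebra F L] (G : Set (L ≃ₐ[F] L))
    (E : Subfield L) (x1 : L) (dd : L) (D j : ℕ) (f : L) : Prop :=
  ∃ s : Finset (L ≃ₐ[F] L), ↑s ⊆ G ∧ ∃ a : (L ≃ₐ[F] L) → L,
    (∀ g ∈ s, IsPolyDeg E x1 D (a g)) ∧ f = ∑ g ∈ s, a g / (g dd) ^ j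

/-- `p` and `p'` are `G`-equivalent: `p = c · g(p')` for some nonzero `c ∈ F` and `g ∈ G`. -/
def GEquivSet {F L : Type*} [Field F] [Field L] [Algebra F L] (G : Set (L ≃ₐ[F] L))
    (p p' : L) : Prop :=
  ∃ c : F, c ≠ 0 ∧ ∃ g ∈ G, p = algebraMap F L c * g p'

/-- `w` divides `p` inside the ring `E[x1]`. -/
def DvdE {L : Type*} [Field L] (E : Subfield L) (x1 w p : L) : Prop :=
  ∃ u : L, IsPolyE E x1 u ∧ p = w * u

/-- `p ∈ E[x₁]` is normal w.r.t. `θ1`: `gcd(p, θ1^ℓ(p)) = 1` for all nonzero `ℓ ∈ ℤ`,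
i.e. every common divisor (in `E[x₁]`) of `p` and `θ1^ℓ(p)` is a unit (lies in `E`). -/
def NormalWrt {F L : Type*} [Field F] [Field L] [Algebra F L] (E : Subfield L) (x1 : L)
    (θ1 : L ≃ₐ[F] L) (p : L) : Prop :=
  ∀ ℓ : ℤ, ℓ ≠ 0 → ∀ w : L, IsPolyE E x1 w →
    DvdE E x1 w p → DvdE E x1 w ((θ1 ^ ℓ) p) → w ∈ E

/-- The isotropy group of `p` (in exponent-vector coordinates): the subgroup of `ℤ^ι`
of all `α` with `Θ(α)(p) = c·p` for some nonzero `c ∈ F`. -/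
def isotropyZ {F L : Type*} [Field F] [Field L] [Algebra F L] {ι : Type*}
    (Θ : (ι → ℤ) → (L ≃ₐ[F] L))
    (hadd : ∀ α β, Θ (α + β) = Θ α * Θ β) (h0 : Θ 0 = 1) (p : L) :
    AddSubgroup (ι → ℤ) where
  carrier := {α | ∃ c : F, c ≠ 0 ∧ Θ α p = algebraMap F L c * p}
  zero_mem' := ⟨1, one_ne_zero, by simp [h0]⟩
  add_mem' := by
    rintro α β ⟨c, hc, hcp⟩ ⟨e, he, hep⟩
    refine ⟨e * c, mul_ne_zero he hc, ?_⟩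
    rw [hadd, AlgEquiv.mul_apply, hep, map_mul, AlgEquiv.commutes, hcp, map_mul]
    ring
  neg_mem' := by
    rintro α ⟨c, hc, hcp⟩
    refine ⟨c⁻¹, inv_ne_zero hc, ?_⟩
    have h1 : Θ (-α) (Θ α p) = p := by
      rw [← AlgEquiv.mul_apply, ← hadd, neg_add_cancel, h0, AlgEquiv.one_apply]
    rw [hcp, map_mul, AlgEquiv.commutes] at h1
    have hc0 : (algebraMap F L) c ≠ 0 :=
      (map_ne_zero_iff _ (algebraMap F L).injective).mpr hc
    rw [map_inv₀, eq_inv_mul_iff_mul_eq₀ hc0]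
    exact h1

end

/-- A linearly independent family of `r ≤ m` integer vectors of length `m` consists of the first
`r` rows of some nonsingular integer matrix. -/
theorem exists_det_ne_zero_of_linearIndependent {r m : ℕ} (hrm : r ≤ m)
    (β : Fin r → Fin m → ℤ) (hβ : LinearIndependent ℤ β) :
    ∃ B : Matrix (Fin m) (Fin m) ℤ, B.det ≠ 0 ∧ ∀ i, B (Fin.castLE hrm i) = β i := by
  have key : ∀ s (hrs : r ≤ s), s ≤ m → ∃ v : Fin s → Fin m → ℤ,
      LinearIndependent ℤ v ∧ ∀ i, v (Fin.castLE hrs i) = β i := by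
    intro s hrs
    induction s, hrs using Nat.le_induction with
    | base => exact fun _ => ⟨β, hβ, fun _ => rfl⟩
    | succ s hrs ih =>
      intro hsm
      obtain ⟨v, hv, hvβ⟩ := ih (by lia)
      obtain ⟨x, hx⟩ := exists_linearIndependent_snoc_of_lt_finrank hv (by simpa using hsm)
      refine ⟨_, hx, fun i => ?_⟩
      rw [← hvβ i]
      exact Fin.snoc_castSucc (α := fun _ => Fin m → ℤ) x v (Fin.castLE hrs i)
  obtain ⟨B, hB, hBβ⟩ := key m hrm le_rfl
  refine ⟨B, fun hdet => ?_, hBβ⟩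
  obtain ⟨v, hv, hvB⟩ := Matrix.exists_vecMul_eq_zero_iff.mpr hdet
  refine hv (funext fun i => Fintype.linearIndependent_iff.mp hB v ?_ i)
  rw [← hvB]
  ext j
  simp [Matrix.vecMul, dotProduct, Finset.sum_apply]

/-- If every `x i` has a common positive power in the image of a `K`-algebra map `φ` and the `x i`
generate the target field over `K`, then `φ` is finite. -/
theorem finite_of_pow_mem_range {K A L ι : Type*} [Field K] [Field A] [Field L]
    [Algebra K A] [Algebra K L] [Finite ι] (φ : A →ₐ[K] L) (x : ι → L)
    (hx : IntermediateField.adjoin K (Set.range x) = ⊤) {d : ℕ} (hd : 0 < d)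
    (hpow : ∀ i, x i ^ d ∈ φ.range) : φ.toRingHom.Finite := by
  let : Algebra A L := φ.toRingHom.toAlgebra
  have : IsScalarTower K A L := .of_algebraMap_eq fun a => (φ.commutes a).symm
  have hint : ∀ y ∈ Set.range x, IsIntegral A y := by
    rintro _ ⟨i, rfl⟩
    obtain ⟨a, ha⟩ := hpow i
    refine IsIntegral.of_pow hd ?_
    rw [← ha]
    exact isIntegral_algebraMap
  have hfin := IntermediateField.finiteDimensional_adjoin hint
  have htop : IntermediateField.adjoin A (Set.range x) = ⊤ := by
    refine IntermediateField.restrictScalars_injective K (top_le_iff.mp ?_)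
    rw [← hx, IntermediateField.adjoin_le_iff]
    exact IntermediateField.subset_adjoin A _
  rw [htop] at hfin
  exact Module.Finite.equiv (IntermediateField.topEquiv (F := A) (E := L)).toLinearEquiv

/-- Summability with respect to automorphisms descends along finite field extensions which
intertwine the automorphisms. -/
theorem summable_iff_of_finite {A L ι : Type*} [Field A] [CharZero A] [Field L] [Fintype ι]
    (φ : A →+* L) (hφ : φ.Finite) (σ : ι → A ≃+* A) (τ : ι → L ≃+* L)
    (h : ∀ i x, φ (σ i x) = τ i (φ x)) (f : A) :
    (∃ g : ι → A, f = ∑ i, (σ i (g i) - g i)) ↔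
      ∃ g : ι → L, φ f = ∑ i, (τ i (g i) - g i) := by
  constructor
  · rintro ⟨g, rfl⟩
    exact ⟨fun i => φ (g i), by simp [h]⟩
  · rintro ⟨g, hg⟩
    let : Algebra A L := φ.toAlgebra
    have : Module.Finite A L := hφ
    have hn : (Module.finrank A L : A) ≠ 0 := Nat.cast_ne_zero.mpr Module.finrank_pos.ne'
    have htr : ∀ i x, Algebra.trace A L (τ i x) = σ i (Algebra.trace A L x) := by
      intro i x
      rw [Algebra.trace_eq_of_equiv_equiv (σ i) (τ i) (RingHom.ext (h i)) x,
        RingEquiv.apply_symm_apply]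
    refine ⟨fun i => (Module.finrank A L : A)⁻¹ * Algebra.trace A L (g i), ?_⟩
    have hf : (Module.finrank A L : A) * f = ∑ i, (σ i (Algebra.trace A L (g i)) -
        Algebra.trace A L (g i)) := by
      rw [← nsmul_eq_mul, ← Algebra.trace_algebraMap (S := L)]
      change Algebra.trace A L (φ f) = _
      simp [hg, htr]
    rw [eq_comm, ← inv_mul_cancel_left₀ hn f, hf, Finset.mul_sum]
    simp [mul_sub]

theorem prod_zpow_eq_zpow_sum {G ι : Type*} [CommGroup G] (s : Finset ι) (f : ι → ℤ) (a : G) :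
    ∏ i ∈ s, a ^ f i = a ^ ∑ i ∈ s, f i := by
  classical
  induction s using Finset.induction_on with
  | empty => simp
  | insert i s hi ih => rw [Finset.prod_insert hi, Finset.sum_insert hi, zpow_add, ih]

/-- Raising Laurent monomials with exponent matrix `B` to the exponents of the adjugate of `B`. -/
theorem prod_monomial_zpow_adjugate {L ι : Type*} [Field L] [Fintype ι] [DecidableEq ι]
    (x : ι → L) (hx : ∀ i, x i ≠ 0) (B : Matrix ι ι ℤ) (l : ι) :
    ∏ j, (∏ i, x i ^ B i j) ^ B.adjugate j l = x l ^ B.det := by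
  simp_rw [← Finset.prod_zpow, ← zpow_mul]
  rw [Finset.prod_comm]
  have h : ∀ i, ∏ j, x i ^ (B i j * B.adjugate j l) = x i ^ ((B * B.adjugate) i l) := by
    intro i
    rw [Matrix.mul_apply]
    simpa using congrArg Units.val (prod_zpow_eq_zpow_sum
      Finset.univ (fun j => B i j * B.adjugate j l) (Units.mk0 _ (hx i)))
  simp_rw [h, Matrix.mul_adjugate, Matrix.smul_apply, Matrix.one_apply]
  rw [Finset.prod_eq_single l] <;> simp +contextual

theorem pow_natAbs_det_mem {L ι S : Type*} [Field L] [Fintype ι] [DecidableEq ι] [SetLike S L]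
    [SubfieldClass S L] (E : S) (x : ι → L) (hx : ∀ i, x i ≠ 0) (B : Matrix ι ι ℤ)
    (hE : ∀ j, ∏ i, x i ^ B i j ∈ E) (l : ι) : x l ^ B.det.natAbs ∈ E := by
  have h : x l ^ B.det ∈ E := by
    rw [← prod_monomial_zpow_adjugate x hx B l]
    exact prod_mem fun j _ => zpow_mem (hE j) _
  rw [← zpow_natCast]
  rcases Int.natAbs_eq B.det with hd | hd
  · rwa [← hd]
  · rw [← neg_eq_iff_eq_neg.mpr hd, zpow_neg]
    exact inv_mem h

theorem xv_ne_zero {K : Type*} [Field K] {m : ℕ} (i : Fin m) : (xv i : MvRat K m) ≠ 0 := by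
  simp [xv]

theorem MvRat.algHom_ext {K A : Type*} [Field K] {m : ℕ} [Field A] [Algebra K A]
    {f g : MvRat K m →ₐ[K] A} (h : ∀ i, f (xv i) = g (xv i)) : f = g := by
  refine IsLocalization.algHom_ext (nonZeroDivisors (MvPolynomial (Fin m) K)) ?_
  exact MvPolynomial.algHom_ext h

theorem adjoin_range_xv (K : Type*) [Field K] (m : ℕ) :
    IntermediateField.adjoin K (Set.range (xv : Fin m → MvRat K m)) = ⊤ := by
  refine top_le_iff.mp fun f _ => ?_
  have hpoly : ∀ p : MvPolynomial (Fin m) K, algebraMap _ (MvRat K m) p ∈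
      IntermediateField.adjoin K (Set.range (xv : Fin m → MvRat K m)) := by
    intro p
    induction p using MvPolynomial.induction_on with
    | C a => exact IntermediateField.algebraMap_mem _ a
    | add p q hp hq => rw [map_add]; exact add_mem hp hq
    | mul_X p i hp =>
      rw [map_mul]
      exact mul_mem hp (IntermediateField.subset_adjoin K _ ⟨i, rfl⟩)
  obtain ⟨a, b, -, rfl⟩ := IsFractionRing.div_surjective (A := MvPolynomial (Fin m) K) f
  exact div_mem (hpoly a) (hpoly b)

theorem algebraicIndependent_xv (K : Type*) [Field K] (m : ℕ) :
    AlgebraicIndependent K (xv : Fin m → MvRat K m) := by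
  have := (MvPolynomial.algebraicIndependent_X (Fin m) K).map'
    (f := IsScalarTower.toAlgHom K (MvPolynomial (Fin m) K) (MvRat K m))
    (IsFractionRing.injective _ _)
  exact this

/-- Laurent monomials with nonsingular exponent matrix are algebraically independent. -/
theorem algebraicIndependent_monomial {K : Type*} [Field K] {m : ℕ}
    (B : Matrix (Fin m) (Fin m) ℤ) (hB : B.det ≠ 0) :
    AlgebraicIndependent K fun j => ∏ i, (xv i : MvRat K m) ^ B i j := by
  set M : Fin m → MvRat K m := fun j => ∏ i, xv i ^ B i j
  let E := IntermediateField.adjoin K (Set.range M)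
  have hfin : E.val.toRingHom.Finite := by
    refine finite_of_pow_mem_range E.val xv (adjoin_range_xv K m) (Int.natAbs_pos.mpr hB)
      fun l => ?_
    exact ⟨⟨_, pow_natAbs_det_mem E xv xv_ne_zero B
      (fun j => IntermediateField.subset_adjoin K _ ⟨j, rfl⟩) l⟩, rfl⟩
  have : Module.Finite E (MvRat K m) := hfin
  have hE : Algebra.IsAlgebraic E (MvRat K m) := inferInstance
  open scoped IntermediateField.algebraAdjoinAdjoin in
  have : Algebra.IsAlgebraic (Algebra.adjoin K (Set.range M)) (MvRat K m) :=
    (IsFractionRing.comap_isAlgebraic_iff (K := E)).mpr hE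
  exact (Algebra.IsAlgebraic.isTranscendenceBasis_of_lift_le_trdeg_of_finite K M
    (algebraicIndependent_xv K m).lift_cardinalMk_le_trdeg).1

/-- Laurent monomials with nonsingular exponent matrix define a finite endomorphism of `K(z)`. -/
theorem exists_algHom_monomial {K : Type*} [Field K] {m : ℕ}
    (B : Matrix (Fin m) (Fin m) ℤ) (hB : B.det ≠ 0) :
    ∃ φ : MvRat K m →ₐ[K] MvRat K m, φ.toRingHom.Finite ∧
      ∀ j, φ (xv j) = ∏ i, xv i ^ B i j := by
  have hinj : Function.Injective
      (MvPolynomial.aeval fun j => ∏ i, (xv i : MvRat K m) ^ B i j :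
        MvPolynomial (Fin m) K →ₐ[K] MvRat K m) := algebraicIndependent_monomial B hB
  obtain ⟨φ, hφ⟩ : ∃ φ : MvRat K m →ₐ[K] MvRat K m, ∀ j, φ (xv j) = ∏ i, xv i ^ B i j := by
    refine ⟨IsFractionRing.liftAlgHom hinj, fun j => ?_⟩
    rw [IsFractionRing.liftAlgHom_apply, xv, IsFractionRing.lift_algebraMap]
    exact MvPolynomial.aeval_X _ j
  refine ⟨φ, finite_of_pow_mem_range φ xv (adjoin_range_xv K m) (Int.natAbs_pos.mpr hB)
    fun l => ?_, hφ⟩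
  exact pow_natAbs_det_mem φ.fieldRange xv xv_ne_zero B
    (fun j => AlgHom.mem_fieldRange.mpr ⟨xv j, hφ j⟩) l

/-- A common eigenvector of the `θ i` is an eigenvector of the product of their powers. -/
theorem thetaPowS_apply_eigenvector {K L ι : Type*} [Field K] [Field L] [Algebra K L] [Fintype ι]
    (θ : ι → (L ≃ₐ[K] L)) (α : ι → ℤ) (c : ι → Kˣ) (x : L)
    (h : ∀ i, θ i x = algebraMap K L (c i) * x) :
    thetaPowS θ α x = algebraMap K L ((∏ i, c i ^ α i : Kˣ) : K) * x := by
  let S : Subgroup ((L ≃ₐ[K] L) × Kˣ) :=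
    { carrier := {p | p.1 x = algebraMap K L p.2 * x}
      one_mem' := by simp
      mul_mem' := by
        rintro ⟨a, c⟩ ⟨b, d⟩ (ha : a x = _) (hb : b x = _)
        change a (b x) = _
        rw [hb, map_mul, AlgEquiv.commutes, ha]
        simp only [Prod.snd_mul, Units.val_mul, map_mul]
        ring
      inv_mem' := by
        rintro ⟨a, c⟩ (ha : a x = _)
        change a.symm x = algebraMap K L ((c⁻¹ : Kˣ) : K) * x
        rw [AlgEquiv.symm_apply_eq, map_mul, AlgEquiv.commutes, ha, ← mul_assoc, ← map_mul]
        simp }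
  have hS : (Finset.univ.toList.map fun i => (θ i, c i) ^ α i).prod ∈ S := by
    refine list_prod_mem fun p hp => ?_
    obtain ⟨i, -, rfl⟩ := List.mem_map.mp hp
    exact zpow_mem (show (θ i, c i) ∈ S from h i) _
  have h1 : (Finset.univ.toList.map fun i => (θ i, c i) ^ α i).prod =
      (thetaPowS θ α, ∏ i, c i ^ α i) := by
    refine Prod.ext ?_ ?_
    · rw [thetaPowS, ← MonoidHom.coe_fst, map_list_prod, List.map_map]
      rfl
    · rw [← MonoidHom.coe_snd, map_list_prod, List.map_map, ← Finset.prod_map_toList]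
      rfl
  rw [h1] at hS
  exact hS

set_option maxHeartbeats 2000000 in
set_option synthInstance.maxHeartbeats 1000000 in
/-- **Proposition: difference transformation, q-shift case.** Let `K = F(y)`
and let `τ₁,…,τ_r` (`1 ≤ r ≤ m`), `τᵢ = τ_z^{βᵢ}`, be independent elements of
`G^τ = ⟨τ_{q,z₁},…,τ_{q,z_m}⟩`. Then there is an injective `K`-algebra endomorphism `φ` of
`K(z)` with `φ∘τᵢ = τ_{q,zᵢ}∘φ` for all `i`, and furthermore `f ∈ K(z)` is
`(τ₁,…,τ_r)`-summable in `K(z)` iff `φ(f)` is `(τ_{q,z₁},…,τ_{q,z_r})`-summable in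
`K(z)`. -/
theorem stmt_14 {F : Type*} [Field F] [CharZero F] {k m : ℕ}
    (q : F) (hq0 : q ≠ 0) (hq : ∀ l : ℤ, l ≠ 0 → q ^ l ≠ 1)
    (τ : Fin m → (MvRat (MvRat F k) m ≃ₐ[MvRat F k] MvRat (MvRat F k) m))
    (hτ : ∀ i : Fin m, τ i (xv i) =
      algebraMap F (MvRat (MvRat F k) m) q * xv i)
    (hτfix : ∀ i l : Fin m, i ≠ l → τ i (xv l) = xv l)
    (r : ℕ) (hr1 : 1 ≤ r) (hrm : r ≤ m)
    (β : Fin r → (Fin m → ℤ))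
    -- independence of `τ₁,…,τ_r`: `τ₁^{ℓ₁}⋯τ_r^{ℓ_r} = 1` forces `ℓ = 0`
    (hindep : ∀ ℓ : Fin r → ℤ,
      thetaPowS (fun i : Fin r => thetaPowS τ (β i)) ℓ = 1 → ℓ = 0) :
    ∃ φ : MvRat (MvRat F k) m →ₐ[MvRat F k] MvRat (MvRat F k) m,
      Function.Injective φ ∧
      (∀ (i : Fin r) (x : MvRat (MvRat F k) m),
        φ (thetaPowS τ (β i) x) = τ (Fin.castLE hrm i) (φ x)) ∧
      ∀ f : MvRat (MvRat F k) m,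
        ((∃ g : Fin r → MvRat (MvRat F k) m,
            f = ∑ i : Fin r, (thetaPowS τ (β i) (g i) - g i)) ↔
          (∃ g : Fin r → MvRat (MvRat F k) m,
            φ f = ∑ i : Fin r, (τ (Fin.castLE hrm i) (g i) - g i))) := by
  let c : (MvRat F k)ˣ := Units.map (algebraMap F (MvRat F k)).toMonoidHom (Units.mk0 q hq0)
  have hc : algebraMap F (MvRat (MvRat F k) m) q =
      algebraMap (MvRat F k) (MvRat (MvRat F k) m) c :=
    IsScalarTower.algebraMap_apply F (MvRat F k) (MvRat (MvRat F k) m) q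
  have hτc : ∀ i l, τ i (xv l) = algebraMap (MvRat F k) (MvRat (MvRat F k) m)
      ((if i = l then c else 1 : (MvRat F k)ˣ) : MvRat F k) * xv l := by
    intro i l
    split_ifs with hil
    · rw [← hil, hτ, hc]
    · simp [hτfix i l hil]
  have hβ : ∀ (α : Fin m → ℤ) l, thetaPowS τ α (xv l) =
      algebraMap (MvRat F k) (MvRat (MvRat F k) m) ((c ^ α l : (MvRat F k)ˣ) : MvRat F k) *
        xv l := by
    intro α l
    rw [thetaPowS_apply_eigenvector τ α _ _ fun i => hτc i l]
    congr 3
    rw [Finset.prod_eq_single l] <;> simp +contextual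
  have hlin : LinearIndependent ℤ β := by
    refine Fintype.linearIndependent_iff.mpr fun ℓ hℓ => congrFun (hindep ℓ ?_)
    suffices h : (thetaPowS (fun i => thetaPowS τ (β i)) ℓ).toAlgHom = AlgHom.id _ _ from
      AlgEquiv.ext fun x => DFunLike.congr_fun h x
    refine MvRat.algHom_ext fun l => ?_
    refine (thetaPowS_apply_eigenvector _ ℓ _ _ fun i => hβ (β i) l).trans ?_
    have hl : ∑ i, β i l * ℓ i = 0 := by
      simpa [Finset.sum_apply, mul_comm] using congrFun hℓ l
    have hprod : ∏ i, (c ^ β i l) ^ ℓ i = 1 := by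
      simp_rw [← zpow_mul]
      rw [prod_zpow_eq_zpow_sum, hl, zpow_zero]
    rw [hprod]
    simp
  obtain ⟨B, hB, hBβ⟩ := exists_det_ne_zero_of_linearIndependent hrm β hlin
  obtain ⟨φ, hφfin, hφ⟩ := exists_algHom_monomial (K := MvRat F k) B hB
  have hcomm : ∀ (i : Fin r) (x : MvRat (MvRat F k) m),
      φ (thetaPowS τ (β i) x) = τ (Fin.castLE hrm i) (φ x) := by
    intro i
    suffices h : φ.comp (thetaPowS τ (β i)).toAlgHom =
        (τ (Fin.castLE hrm i)).toAlgHom.comp φ from fun x => DFunLike.congr_fun h x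
    refine MvRat.algHom_ext fun l => ?_
    change φ (thetaPowS τ (β i) (xv l)) = τ (Fin.castLE hrm i) (φ (xv l))
    rw [hβ, map_mul, AlgHom.commutes, hφ, map_prod]
    simp_rw [map_zpow₀, hτc, mul_zpow]
    rw [Finset.prod_mul_distrib]
    congr 1
    rw [Finset.prod_eq_single (Fin.castLE hrm i)]
    · simp [← hBβ]
    · intro j _ hj
      simp [hj.symm]
    · simp
  have : CharZero (MvRat F k) := charZero_of_injective_algebraMap (algebraMap F _).injective
  have : CharZero (MvRat (MvRat F k) m) :=
    charZero_of_injective_algebraMap (algebraMap (MvRat F k) _).injective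
  exact ⟨φ, φ.toRingHom.injective, hcomm, summable_iff_of_finite φ.toRingHom hφfin
    (fun i => (thetaPowS τ (β i)).toRingEquiv) (fun i => (τ (Fin.castLE hrm i)).toRingEquiv) hcomm⟩
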